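/- arXiv:2509.19935 — 2 statements merged into one kernel-verified Lean document; each statement's English description precedes it below -/
import Mathlib

section
/- For every positive integer k, both P(N_k ≥ k) ≤ 1/2 + 1/√(2πk) and P(N_k ≤ k) ≤ 1/2 + 1/√(2πk), where N_k has the Poisson distribution with mean k. -/
open Real

/-- Poisson probability mass function with mean `lam`: `P(N_lam = j)`. -/
noncomputable def poissonProb (lam : ℝ) (j : ℕ) : ℝ := lam ^ j * Real.exp (-lam) / j.factorial

lemma poissonProb_nonneg {lam : ℝ} (h : 0 ≤ lam) (j : ℕ) : 0 ≤ poissonProb lam j := by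
  unfold poissonProb; positivity

lemma hasSum_poissonProb (lam : ℝ) : HasSum (poissonProb lam) 1 := by
  have h : HasSum (fun j : ℕ => lam ^ j / (j.factorial : ℝ)) (Real.exp lam) := by
    rw [Real.exp_eq_exp_ℝ]; exact NormedSpace.expSeries_div_hasSum_exp lam
  have h2 := h.mul_right (Real.exp (-lam))
  rw [← Real.exp_add, add_neg_cancel, Real.exp_zero] at h2
  refine h2.congr_fun fun j => ?_
  unfold poissonProb; ring

lemma poissonProb_succ (lam : ℝ) (j : ℕ) :
    poissonProb lam (j + 1) * (j + 1) = poissonProb lam j * lam := by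
  unfold poissonProb
  rw [Nat.factorial_succ]
  push_cast
  have : (j.factorial : ℝ) ≠ 0 := by positivity
  field_simp
  ring

/-- Below the mean `k`, the mass function is dominated by its reflection about `k - 1 / 2`. -/
lemma poissonProb_le_reflect {k : ℕ} (i : ℕ) (m : ℕ) (h : m + i + 1 = k) :
    poissonProb k m ≤ poissonProb k (k + i) := by
  induction i generalizing m with
  | zero =>
    have h1 := poissonProb_succ k m
    subst h
    push_cast at h1 ⊢
    have : (0 : ℝ) < m + 1 := by positivity
    simp only [add_zero] at h1 ⊢
    exact (mul_right_cancel₀ this.ne' h1).ge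
  | succ i ih =>
    have h0 := ih (m + 1) (by omega)
    have h1 := poissonProb_succ k m
    have h2 := poissonProb_succ k (k + i)
    have hk : (k : ℝ) = m + i + 2 := by rw [← h]; push_cast; ring
    have hp := poissonProb_nonneg (Nat.cast_nonneg (α := ℝ) k) (k + i)
    have hm : (0 : ℝ) ≤ m := by positivity
    have hi : (0 : ℝ) ≤ i := by positivity
    rw [← add_assoc]
    push_cast at h2
    have hk0 : (0 : ℝ) < k := by rw [hk]; positivity
    have e1 : poissonProb k m = poissonProb k (m + 1) * (m + 1) / k := by
      field_simp; linarith
    have e2 : poissonProb k (k + i + 1) = poissonProb k (k + i) * k / (k + i + 1) := by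
      field_simp; linarith
    rw [e1, e2, div_le_div_iff₀ hk0 (by positivity)]
    have h3 : ((m : ℝ) + 1) * (k + i + 1) ≤ k * k := by rw [hk]; nlinarith
    calc poissonProb k (m + 1) * (m + 1) * (k + i + 1)
        = poissonProb k (m + 1) * ((m + 1) * (k + i + 1)) := by ring
      _ ≤ poissonProb k (k + i) * (k * k) := by gcongr
      _ = _ := by ring

lemma sum_range_poissonProb_le_half (k : ℕ) :
    ∑ j ∈ Finset.range k, poissonProb k j ≤ 1 / 2 := by
  have h1 : ∑ j ∈ Finset.range k, poissonProb k j
      ≤ ∑ i ∈ Finset.range k, poissonProb k (k + i) := by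
    rw [← Finset.sum_range_reflect]
    refine Finset.sum_le_sum fun i hi => ?_
    have := Finset.mem_range.1 hi
    exact poissonProb_le_reflect i _ (by omega)
  have h2 := (hasSum_poissonProb k).summable.sum_le_tsum (Finset.range (k + k))
    (fun j _ => poissonProb_nonneg (Nat.cast_nonneg k) j)
  rw [(hasSum_poissonProb k).tsum_eq, Finset.sum_range_add] at h2
  linarith

lemma hasDerivAt_sum_poissonProb (k : ℕ) (x : ℝ) :
    HasDerivAt (fun y => ∑ j ∈ Finset.range (k + 1), poissonProb y j) (-poissonProb x k) x := by
  have hexp : HasDerivAt (fun y : ℝ => Real.exp (-y)) (-Real.exp (-x)) x := by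
    simpa using (hasDerivAt_neg x).exp
  induction k with
  | zero => simpa [poissonProb] using hexp
  | succ k ih =>
    simp_rw [Finset.sum_range_succ _ (k + 1)]
    have h := ((hasDerivAt_pow (k + 1) x).mul hexp).div_const ((k + 1).factorial : ℝ)
    refine (ih.add h).congr_deriv ?_
    unfold poissonProb
    rw [Nat.factorial_succ]
    push_cast
    have : (k.factorial : ℝ) ≠ 0 := by positivity
    field_simp
    ring

lemma one_sub_mul_exp_le {s : ℝ} (h0 : 0 ≤ s) (h1 : s < 1) :
    (1 - s) * Real.exp s ≤ (1 + s) * Real.exp (-s) := by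
  have h := Real.hasSum_log_sub_log_of_abs_lt_one (abs_lt.2 ⟨by linarith, h1⟩)
  have h2 := le_hasSum h 0 fun j _ => by positivity
  norm_num at h2
  rw [← Real.exp_log (show 0 < 1 - s by linarith), ← Real.exp_log (show 0 < 1 + s by linarith),
    ← Real.exp_add, ← Real.exp_add, Real.exp_le_exp]
  linarith

/-- The density of the Gamma distribution of shape `k + 1` is larger to the right of its mode. -/
lemma poissonProb_sub_le_add {k : ℕ} {t : ℝ} (h0 : 0 ≤ t) (h1 : t < k) :
    poissonProb (k - t) k ≤ poissonProb (k + t) k := by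
  have hk : (0 : ℝ) < k := h0.trans_lt h1
  have hs := one_sub_mul_exp_le (s := t / k) (by positivity) ((div_lt_one hk).2 h1)
  have hs1 : 0 ≤ 1 - t / k := sub_nonneg.2 ((div_lt_one hk).2 h1).le
  have hp := pow_le_pow_left₀ (by positivity) hs k
  rw [mul_pow, mul_pow, ← Real.exp_nat_mul, ← Real.exp_nat_mul] at hp
  have e1 : (k : ℝ) * (t / k) = t := by field_simp
  rw [mul_neg, e1] at hp
  have a1 : (k : ℝ) - t = k * (1 - t / k) := by field_simp
  have a2 : (k : ℝ) + t = k * (1 + t / k) := by field_simp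
  unfold poissonProb
  rw [show -((k : ℝ) - t) = -k + t by ring, show -((k : ℝ) + t) = -k + -t by ring,
    Real.exp_add, Real.exp_add, a1, a2, mul_pow, mul_pow]
  gcongr ?_ / _
  calc _ = (k : ℝ) ^ k * Real.exp (-k) * ((1 - t / k) ^ k * Real.exp t) := by ring
    _ ≤ (k : ℝ) ^ k * Real.exp (-k) * ((1 + t / k) ^ k * Real.exp (-t)) := by gcongr
    _ = _ := by ring

lemma half_le_sum_range_succ_poissonProb (k : ℕ) :
    1 / 2 ≤ ∑ j ∈ Finset.range (k + 1), poissonProb k j := by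
  let F : ℝ → ℝ := fun y => ∑ j ∈ Finset.range (k + 1), poissonProb y j
  have hd : ∀ t : ℝ, HasDerivAt (fun t => F (k + t) + F (k - t))
      (-poissonProb (k + t) k + poissonProb (k - t) k) t := by
    intro t
    have h1 := (hasDerivAt_sum_poissonProb k (k + t)).comp_const_add (k : ℝ) t
    have h2 := (hasDerivAt_sum_poissonProb k (k - t)).comp_const_sub (k : ℝ) t
    exact (h1.add h2).congr_deriv (by rw [neg_neg])
  have hanti : AntitoneOn (fun t => F (k + t) + F (k - t)) (Set.Icc 0 (k : ℝ)) := by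
    refine antitoneOn_of_deriv_nonpos (convex_Icc _ _)
      (fun t _ => (hd t).continuousAt.continuousWithinAt)
      (fun t _ => (hd t).differentiableAt.differentiableWithinAt) fun t ht => ?_
    rw [interior_Icc] at ht
    rw [(hd t).deriv]
    linarith [poissonProb_sub_le_add ht.1.le ht.2]
  have hk : (0 : ℝ) ≤ k := Nat.cast_nonneg k
  have h := hanti (Set.left_mem_Icc.2 hk) (Set.right_mem_Icc.2 hk) hk
  simp only [add_zero, sub_zero, sub_self] at h
  have h0 : F 0 = 1 := by
    simp [F, poissonProb, Finset.sum_range_succ']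
  have h2 : 0 ≤ F (k + k) := Finset.sum_nonneg fun j _ => poissonProb_nonneg (by positivity) j
  change 1 / 2 ≤ F k
  linarith

lemma poissonProb_self_le {k : ℕ} (hk : 0 < k) :
    poissonProb k k ≤ 1 / Real.sqrt (2 * π * k) := by
  have h := Stirling.le_factorial_stirling k
  have hk' : (0 : ℝ) < k := by exact_mod_cast hk
  unfold poissonProb
  rw [div_le_div_iff₀ (by positivity) (by positivity), one_mul]
  refine le_trans (le_of_eq ?_) h
  rw [div_pow, ← Real.exp_nat_mul, mul_one, Real.exp_neg]
  ring

theorem poisson_median_upper (k : ℕ) (hk : 0 < k) :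
    (∑' j : ℕ, if k ≤ j then poissonProb (k : ℝ) j else 0) ≤ 1 / 2 + 1 / Real.sqrt (2 * π * k) ∧
    (∑' j : ℕ, if j ≤ k then poissonProb (k : ℝ) j else 0) ≤ 1 / 2 + 1 / Real.sqrt (2 * π * k) := by
  have hp := poissonProb_self_le hk
  have hlow := sum_range_poissonProb_le_half k
  have hup := half_le_sum_range_succ_poissonProb k
  rw [Finset.sum_range_succ] at hup
  constructor
  · have hfin : HasSum (fun j : ℕ => if j < k then poissonProb (k : ℝ) j else 0)
        (∑ j ∈ Finset.range k, poissonProb k j) := by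
      rw [Finset.sum_congr rfl fun j hj => (if_pos (Finset.mem_range.1 hj)).symm]
      exact hasSum_sum_of_ne_finset_zero fun j hj => if_neg (by simpa using hj)
    have h := (hasSum_poissonProb k).sub hfin
    have e : (fun j : ℕ => if k ≤ j then poissonProb (k : ℝ) j else 0) =
        fun j => poissonProb (k : ℝ) j - if j < k then poissonProb (k : ℝ) j else 0 := by
      funext j
      by_cases hj : k ≤ j
      · simp [hj, not_lt.2 hj]
      · simp [hj, not_le.1 hj]
    rw [e, h.tsum_eq]
    linarith
  · rw [tsum_eq_sum (s := Finset.range (k + 1))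
      (fun j hj => if_neg (by simp at hj; omega)),
      Finset.sum_congr rfl fun j hj => if_pos (Nat.lt_succ_iff.1 (Finset.mem_range.1 hj)),
      Finset.sum_range_succ]
    linarith
end

section
/- Let n be a positive integer, let 0 < x ≤ b, and set β = ⌈nb⌉/n. Then P(N_{nx} ≥ nβ) ≤ (1 + x/(β − x + 1/n))·exp(−n·H(β,x))/√(2πnβ). -/
open Real

/-- Kullback–Leibler divergence between Poisson random variables with means `t` and `x`. -/
noncomputable def H (t x : ℝ) : ℝ := t * Real.log (t / x) - t + x

lemma summable_poissonProb (lam : ℝ) : Summable (poissonProb lam) := by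
  refine ((Real.summable_pow_div_factorial lam).mul_right (Real.exp (-lam))).congr fun j => ?_
  unfold poissonProb
  ring

lemma poissonProb_add_le {lam : ℝ} (h : 0 ≤ lam) (m j : ℕ) :
    poissonProb lam (m + j) ≤ poissonProb lam m * (lam / (m + 1)) ^ j := by
  have hfac : (m.factorial : ℝ) * (m + 1) ^ j ≤ (m + j).factorial := by
    exact_mod_cast Nat.factorial_mul_pow_le_factorial
  calc poissonProb lam (m + j)
      = lam ^ (m + j) * Real.exp (-lam) / (m + j).factorial := rfl
    _ ≤ lam ^ (m + j) * Real.exp (-lam) / (m.factorial * (m + 1) ^ j) := by gcongr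
    _ = poissonProb lam m * (lam / (m + 1)) ^ j := by
      unfold poissonProb
      rw [div_pow, pow_add]
      field_simp

lemma tsum_poissonProb_tail_le {lam : ℝ} (h : 0 ≤ lam) {m : ℕ} (hm : lam < m + 1) :
    ∑' k : ℕ, (if m ≤ k then poissonProb lam k else 0) ≤
      (1 + lam / (m - lam + 1)) * poissonProb lam m := by
  have hr0 : 0 ≤ lam / (m + 1) := by positivity
  have hr1 : lam / (m + 1) < 1 := by rwa [div_lt_one (by positivity)]
  have hs : Summable fun k : ℕ => if m ≤ k then poissonProb lam k else 0 := by
    refine (summable_poissonProb lam).of_nonneg_of_le (fun k => ?_) (fun k => ?_)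
    all_goals
      have := poissonProb_nonneg h k
      split_ifs <;> simp [this]
  have hzero : ∑ k ∈ Finset.range m, (if m ≤ k then poissonProb lam k else 0) = 0 :=
    Finset.sum_eq_zero fun k hk => if_neg (by simpa using hk)
  rw [← hs.sum_add_tsum_nat_add m, hzero, zero_add]
  calc ∑' j : ℕ, (if m ≤ j + m then poissonProb lam (j + m) else 0)
      ≤ ∑' j : ℕ, poissonProb lam m * (lam / (m + 1)) ^ j := by
        refine Summable.tsum_le_tsum (fun j => ?_) ((summable_nat_add_iff m).2 hs)
          ((summable_geometric_of_lt_one hr0 hr1).mul_left _)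
        rw [if_pos (Nat.le_add_left m j), add_comm]
        exact poissonProb_add_le h m j
    _ = (1 + lam / (m - lam + 1)) * poissonProb lam m := by
        rw [tsum_mul_left, tsum_geometric_of_lt_one hr0 hr1]
        have h1 : (m : ℝ) - lam + 1 ≠ 0 := by linarith
        have h2 : (m : ℝ) + 1 - lam ≠ 0 := by linarith
        have h3 : (m : ℝ) + 1 ≠ 0 := by positivity
        have h4 : 1 - lam / ((m : ℝ) + 1) = (m - lam + 1) / (m + 1) := by
          field_simp
          ring
        rw [h4]
        field_simp
        ring

lemma poissonProb_le_stirling {lam : ℝ} (h : 0 < lam) {m : ℕ} (hm : 0 < m) :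
    poissonProb lam m ≤ Real.exp (-H m lam) / √(2 * π * m) := by
  have hm' : (0 : ℝ) < m := by exact_mod_cast hm
  have hexp : Real.exp (-H m lam) = lam ^ m * Real.exp (-lam) / (m / Real.exp 1) ^ m := by
    have : -H m lam = m * Real.log (lam / m) + m * 1 + -lam := by
      rw [H, ← inv_div lam (m : ℝ), Real.log_inv]
      ring
    rw [this, Real.exp_add, Real.exp_add, Real.exp_nat_mul, Real.exp_nat_mul,
      Real.exp_log (by positivity), div_pow, div_pow]
    field_simp
  rw [hexp, div_div, mul_comm _ √_]
  unfold poissonProb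
  gcongr
  exact Stirling.le_factorial_stirling m

theorem poisson_right_tail_upper' (n : ℕ) (hn : 0 < n) (x b : ℝ) (hx : 0 < x) (hxb : x ≤ b)
    (β : ℝ) (hβ : β = (⌈(n : ℝ) * b⌉ : ℝ) / n) :
    (∑' k : ℕ, if (n : ℝ) * β ≤ k then poissonProb ((n : ℝ) * x) k else 0) ≤
      (1 + x / (β - x + 1 / n)) * Real.exp (-(n : ℝ) * H β x) / Real.sqrt (2 * π * n * β) := by
  have hn' : (0 : ℝ) < n := by exact_mod_cast hn
  have hnb : 0 < (n : ℝ) * b := mul_pos hn' (hx.trans_le hxb)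
  obtain ⟨m, hm⟩ := Int.eq_ofNat_of_zero_le (Int.ceil_pos.2 hnb).le
  have hm0 : 0 < m := by
    have := Int.ceil_pos.2 hnb
    omega
  have hmβ : (n : ℝ) * β = m := by
    rw [hβ, hm]
    push_cast
    field_simp
  have hlam : (n : ℝ) * x ≤ m := by
    have h1 := Int.le_ceil ((n : ℝ) * b)
    rw [hm] at h1
    push_cast at h1
    exact (mul_le_mul_of_nonneg_left hxb hn'.le).trans h1
  have hpos : 0 < (n : ℝ) * x := mul_pos hn' hx
  have hcoef : x / (β - x + 1 / n) = n * x / (m - n * x + 1) := by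
    have : (m : ℝ) - n * x + 1 = n * (β - x + 1 / n) := by
      rw [← hmβ]
      field_simp
    rw [this, mul_div_mul_left _ _ hn'.ne']
  have hH : -(n : ℝ) * H β x = -H m (n * x) := by
    rw [H, H, ← hmβ, mul_div_mul_left _ _ hn'.ne']
    ring
  rw [hcoef, hH, mul_assoc (2 * π), hmβ, mul_div_assoc]
  simp only [Nat.cast_le]
  refine (tsum_poissonProb_tail_le hpos.le (by linarith)).trans ?_
  have hden : 0 ≤ (m : ℝ) - n * x + 1 := by linarith
  gcongr
  exact poissonProb_le_stirling hpos hm0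
end
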